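/- Let S and P be types, let s : ℕ → S be a sequence of states and actor : ℕ → P assign to each step the process taking it, let δ : S → ℕ and Ψ : S → Set P. Assume: (i) δ(s(n)) ≥ 1 for all n; (ii) whenever δ(s(n)) > 1 the set Ψ(s(n)) is nonempty; (iii) if actor(n) ∈ Ψ(s(n)) then δ(s(n+1)) < δ(s(n)); (iv) if actor(n) ∉ Ψ(s(n)) then either δ(s(n+1)) < δ(s(n)), or δ(s(n+1)) = δ(s(n)) and Ψ(s(n+1)) = Ψ(s(n)); and (v) fairness: for every process p ∈ P and every n there exists m ≥ n with actor(m) = p. Then there exists N with δ(s(N)) = 1. -/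

import Mathlib

/-- Abstract starvation-freedom argument: with a distance function δ ≥ 1, nonempty
promoter sets whenever δ > 1, promoter steps strictly decreasing δ, non-promoter steps
not increasing δ (and preserving the promoter set when δ is unchanged), and fairness,
δ eventually reaches 1. -/
theorem stmt_1 {S P : Type*} (s : ℕ → S) (actor : ℕ → P)
    (δ : S → ℕ) (Ψ : S → Set P)
    (h1 : ∀ n, 1 ≤ δ (s n))
    (h2 : ∀ n, 1 < δ (s n) → (Ψ (s n)).Nonempty)
    (h3 : ∀ n, actor n ∈ Ψ (s n) → δ (s (n + 1)) < δ (s n))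
    (h4 : ∀ n, actor n ∉ Ψ (s n) →
      δ (s (n + 1)) < δ (s n) ∨ (δ (s (n + 1)) = δ (s n) ∧ Ψ (s (n + 1)) = Ψ (s n)))
    (h5 : ∀ (p : P) (n : ℕ), ∃ m, n ≤ m ∧ actor m = p) :
    ∃ N, δ (s N) = 1 := by
  obtain ⟨n, hn⟩ : ∃ n, ∀ m, δ (s n) ≤ δ (s m) :=
    ⟨Function.argmin (δ ∘ s), fun m => Function.argmin_le (δ ∘ s) m⟩
  refine ⟨n, (h1 n).antisymm' (not_lt.mp fun hlt => ?_)⟩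
  have hconst : ∀ m, n ≤ m → δ (s m) = δ (s n) ∧ Ψ (s m) = Ψ (s n) := by
    intro m hm
    induction m, hm using Nat.le_induction with
    | base => exact ⟨rfl, rfl⟩
    | succ m _ ih =>
      have hge : ¬ δ (s (m + 1)) < δ (s m) := not_lt.mpr (ih.1 ▸ hn (m + 1))
      obtain ⟨hδ, hΨ⟩ := (h4 m fun hmem => hge (h3 m hmem)).resolve_left hge
      exact ⟨hδ.trans ih.1, hΨ.trans ih.2⟩
  obtain ⟨p, hp⟩ := h2 n hlt
  obtain ⟨m, hm, rfl⟩ := h5 p n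
  obtain ⟨hδ, hΨ⟩ := hconst m hm
  exact (hn (m + 1)).not_gt (hδ ▸ h3 m (hΨ ▸ hp))
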